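/- Let X be a GC_5 set of 21 nodes with no maximal line, and let A0 ∈ X be a node with m-d sequence (5,5,5,3,2) realized by the ordered used lines (ℓ1,ℓ2,ℓ3,ℓ4,ℓ5). Set 𝒜 := X ∩ (ℓ1 ∪ ℓ2 ∪ ℓ3), so #𝒜 = 15, and ℬ := X \ 𝒜, so #ℬ = 6. Then: (i) ℬ is a GC_2 set, and for every B ∈ ℬ the fundamental polynomial of B with respect to X factors as p⋆_{B,X} = ℓ1·ℓ2·ℓ3·p⋆_{B,ℬ}, where p⋆_{B,ℬ} is the fundamental polynomial of B with respect to ℬ; (ii) no node of 𝒜 uses any of the lines ℓ1, ℓ2, ℓ3. -/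

import Mathlib

open MvPolynomial

/-- Evaluation of a bivariate polynomial at a point of the real plane. -/
noncomputable def ev (p : MvPolynomial (Fin 2) ℝ) (A : ℝ × ℝ) : ℝ :=
  MvPolynomial.eval ![A.1, A.2] p

/-- A polynomial of total degree exactly 1, defining a line. -/
def IsLinePoly (l : MvPolynomial (Fin 2) ℝ) : Prop := l.totalDegree = 1

/-- The line (zero set) defined by a polynomial. -/
def lineSet (l : MvPolynomial (Fin 2) ℝ) : Set (ℝ × ℝ) := {A | ev l A = 0}

/-- The number of nodes of `X` lying on the line defined by `l`. -/
noncomputable def nodesOn (X : Set (ℝ × ℝ)) (l : MvPolynomial (Fin 2) ℝ) : ℕ :=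
  (X ∩ lineSet l).ncard

/-- `X` is an `n`-poised set: it has `N = (n+2)(n+1)/2` nodes and the only polynomial of
degree ≤ n vanishing on all of `X` is the zero polynomial. -/
def Poised (n : ℕ) (X : Set (ℝ × ℝ)) : Prop :=
  X.Finite ∧ X.ncard = (n + 2) * (n + 1) / 2 ∧
    ∀ p : MvPolynomial (Fin 2) ℝ, p.totalDegree ≤ n → (∀ A ∈ X, ev p A = 0) → p = 0

/-- `p` is an `n`-fundamental polynomial of the node `A` with respect to `X`. -/
def IsFund (n : ℕ) (X : Set (ℝ × ℝ)) (A : ℝ × ℝ) (p : MvPolynomial (Fin 2) ℝ) : Prop :=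
  p.totalDegree ≤ n ∧ ev p A = 1 ∧ ∀ B ∈ X, B ≠ A → ev p B = 0

/-- `X` is a `GC_n` set: it is `n`-poised and each fundamental polynomial is a product of
`n` linear (degree-1) polynomials. -/
def GCSet (n : ℕ) (X : Set (ℝ × ℝ)) : Prop :=
  Poised n X ∧ ∀ A ∈ X, ∃ p : MvPolynomial (Fin 2) ℝ, IsFund n X A p ∧
    ∃ f : Fin n → MvPolynomial (Fin 2) ℝ, (∀ i, IsLinePoly (f i)) ∧ p = ∏ i, f i

/-- The node `A` uses the line `l`: the linear polynomial `l` divides a fundamental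
polynomial of `A`. -/
def Uses (n : ℕ) (X : Set (ℝ × ℝ)) (A : ℝ × ℝ) (l : MvPolynomial (Fin 2) ℝ) : Prop :=
  ∃ p, IsFund n X A p ∧ l ∣ p

/-- `X` has no maximal line, i.e. no line passes through `n+1` nodes of `X`. -/
def NoMaximalLine (n : ℕ) (X : Set (ℝ × ℝ)) : Prop :=
  ∀ l : MvPolynomial (Fin 2) ℝ, IsLinePoly l → nodesOn X l ≠ n + 1

/-- Number of nodes of `X` on the line `l` which do not lie on any of the lines
`L 0, …, L (s-1)` (the primary node count of `l` at step `s`). -/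
noncomputable def resCount (X : Set (ℝ × ℝ)) (L : Fin 5 → MvPolynomial (Fin 2) ℝ)
    (s : Fin 5) (l : MvPolynomial (Fin 2) ℝ) : ℕ :=
  {B ∈ X | ev l B = 0 ∧ ∀ i : Fin 5, i < s → ev (L i) B ≠ 0}.ncard

/-- `L` is an m-line sequence of the node `A` of the `GC_5` set `X`: it enumerates the five
distinct used lines of `A` (a fundamental polynomial of `A` is, up to a constant, the
product of the `L i`), ordered greedily: at each step `s` the line `L s` has maximal
primary node count among the remaining used lines. -/
def MLineSeq (X : Set (ℝ × ℝ)) (A : ℝ × ℝ) (L : Fin 5 → MvPolynomial (Fin 2) ℝ) : Prop :=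
  (∀ i, IsLinePoly (L i)) ∧
  (∀ i j : Fin 5, i ≠ j → lineSet (L i) ≠ lineSet (L j)) ∧
  (∃ p : MvPolynomial (Fin 2) ℝ, IsFund 5 X A p ∧ ∃ c : ℝ, p = MvPolynomial.C c * ∏ i, L i) ∧
  (∀ s t : Fin 5, s ≤ t → resCount X L s (L t) ≤ resCount X L s (L s))

/-- The node `A` has m-distribution sequence `k`. -/
def HasMDSeq (X : Set (ℝ × ℝ)) (A : ℝ × ℝ) (k : Fin 5 → ℕ) : Prop :=
  ∃ L : Fin 5 → MvPolynomial (Fin 2) ℝ, MLineSeq X A L ∧ ∀ s, resCount X L s (L s) = k s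

lemma ev_mul (p q : MvPolynomial (Fin 2) ℝ) (A : ℝ × ℝ) : ev (p * q) A = ev p A * ev q A := by
  simp [ev]

lemma ev_sub (p q : MvPolynomial (Fin 2) ℝ) (A : ℝ × ℝ) : ev (p - q) A = ev p A - ev q A := by
  simp [ev]

lemma ev_C (c : ℝ) (A : ℝ × ℝ) : ev (C c) A = c := by
  simp [ev]

lemma IsLinePoly.ne_zero {l : MvPolynomial (Fin 2) ℝ} (hl : IsLinePoly l) : l ≠ 0 := by
  rintro rfl
  simp [IsLinePoly] at hl

lemma IsLinePoly.totalDegree_line_mul {l r : MvPolynomial (Fin 2) ℝ} (hl : IsLinePoly l)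
    (hr : r ≠ 0) :
    (l * r).totalDegree = 1 + r.totalDegree := by
  rw [totalDegree_mul_of_isDomain hl.ne_zero hr, hl]

/-- A polynomial of degree one is an affine form with nonzero linear part. -/
lemma IsLinePoly.exists_affine {l : MvPolynomial (Fin 2) ℝ} (hl : IsLinePoly l) :
    ∃ a b c : ℝ, a ^ 2 + b ^ 2 ≠ 0 ∧ l = C a * X 0 + C b * X 1 + C c := by
  have key : l = C (coeff (Finsupp.single 0 1) l) * X 0 + C (coeff (Finsupp.single 1 1) l) * X 1 +
      C (coeff 0 l) := by
    ext m
    by_cases hm : 1 < ∑ i ∈ m.support, m i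
    · rw [coeff_eq_zero_of_totalDegree_lt (by rw [hl]; exact hm)]
      have hd : (C (coeff (Finsupp.single 0 1) l) * X 0 + C (coeff (Finsupp.single 1 1) l) * X 1 +
          C (coeff 0 l) : MvPolynomial (Fin 2) ℝ).totalDegree ≤ 1 := by
        refine (totalDegree_add _ _).trans (max_le ((totalDegree_add _ _).trans (max_le ?_ ?_)) ?_)
        · refine (totalDegree_mul _ _).trans ?_
          rw [totalDegree_C, totalDegree_X]
        · refine (totalDegree_mul _ _).trans ?_
          rw [totalDegree_C, totalDegree_X]
        · simp
      rw [coeff_eq_zero_of_totalDegree_lt (lt_of_le_of_lt hd hm)]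
    · have hs : m 0 + m 1 ≤ 1 := by
        have : ∑ i ∈ m.support, m i = ∑ i, m i :=
          Finset.sum_subset (Finset.subset_univ _) fun i _ hi => Finsupp.notMem_support_iff.1 hi
        rw [this, Fin.sum_univ_two] at hm
        omega
      have hcases : m = 0 ∨ m = Finsupp.single 0 1 ∨ m = Finsupp.single 1 1 := by
        rcases (by omega : (m 0 = 0 ∧ m 1 = 0) ∨ (m 0 = 1 ∧ m 1 = 0) ∨ (m 0 = 0 ∧ m 1 = 1)) with
          h | h | h
        · left; ext i; fin_cases i <;> simp [h]
        · right; left; ext i; fin_cases i <;> simp [h]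
        · right; right; ext i; fin_cases i <;> simp [h]
      rcases hcases with rfl | rfl | rfl <;>
        simp [coeff_C_mul, coeff_X, coeff_C, Finsupp.single_left_inj,
          eq_comm (a := (0 : Fin 2 →₀ ℕ))]
  refine ⟨_, _, _, fun h0 => ?_, key⟩
  have h1 : coeff (Finsupp.single 0 1) l = 0 := by
    nlinarith [sq_nonneg (coeff (Finsupp.single 0 1) l), sq_nonneg (coeff (Finsupp.single 1 1) l)]
  have h2 : coeff (Finsupp.single 1 1) l = 0 := by
    nlinarith [sq_nonneg (coeff (Finsupp.single 0 1) l), sq_nonneg (coeff (Finsupp.single 1 1) l)]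
  rw [h1, h2] at key
  have : l.totalDegree = 0 := by
    rw [key]; simp
  rw [hl] at this
  exact one_ne_zero this

/-- Restriction of polynomials to a line, expressed in an affine parameter `τ` of the line. -/
lemma IsLinePoly.exists_restriction {l : MvPolynomial (Fin 2) ℝ} (hl : IsLinePoly l) :
    ∃ (φ : MvPolynomial (Fin 2) ℝ →ₐ[ℝ] Polynomial ℝ) (τ : ℝ × ℝ → ℝ),
      (∀ p, φ p = 0 ↔ l ∣ p) ∧ (∀ p, (φ p).natDegree ≤ p.totalDegree) ∧
      Set.InjOn τ (lineSet l) ∧ ∀ p, ∀ A ∈ lineSet l, (φ p).eval (τ A) = ev p A := by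
  obtain ⟨a, b, c, hab, rfl⟩ := hl.exists_affine
  obtain ⟨e, he⟩ : ∃ e, e * (a ^ 2 + b ^ 2) = 1 := ⟨_, inv_mul_cancel₀ hab⟩
  set x : Polynomial ℝ := Polynomial.C b * Polynomial.X + Polynomial.C (-(a * c * e)) with hx
  set y : Polynomial ℝ := Polynomial.C (-a) * Polynomial.X + Polynomial.C (-(b * c * e)) with hy
  set t : MvPolynomial (Fin 2) ℝ := C e * (C b * X 0 - C a * X 1) with ht
  set l : MvPolynomial (Fin 2) ℝ := C a * X 0 + C b * X 1 + C c with hldef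
  have hpt : ∀ A ∈ lineSet l, b * (e * (b * A.1 - a * A.2)) + -(a * c * e) = A.1 ∧
      -a * (e * (b * A.1 - a * A.2)) + -(b * c * e) = A.2 := by
    intro A hA
    have h : a * A.1 + b * A.2 + c = 0 := by simpa [lineSet, ev, hldef] using hA
    constructor
    · linear_combination A.1 * he - a * e * h
    · linear_combination A.2 * he - b * e * h
  have hφl : aeval ![x, y] l = 0 := by
    have hx' : aeval ![x, y] (X 0 : MvPolynomial (Fin 2) ℝ) = x := by simp
    have hy' : aeval ![x, y] (X 1 : MvPolynomial (Fin 2) ℝ) = y := by simp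
    have he' : Polynomial.C e * (Polynomial.C a ^ 2 + Polynomial.C b ^ 2) = 1 := by
      rw [← Polynomial.C_pow, ← Polynomial.C_pow, ← Polynomial.C_add, ← Polynomial.C_mul, he,
        Polynomial.C_1]
    rw [hldef, map_add, map_add, map_mul, map_mul, hx', hy', hx, hy]
    simp only [algHom_C, Polynomial.algebraMap_eq, Polynomial.C_mul, Polynomial.C_neg]
    linear_combination -Polynomial.C c * he'
  have hψ : ∀ p : MvPolynomial (Fin 2) ℝ,
      Ideal.Quotient.mkₐ ℝ (Ideal.span {l}) (Polynomial.aeval t (aeval ![x, y] p)) =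
        Ideal.Quotient.mkₐ ℝ (Ideal.span {l}) p := by
    intro p
    suffices h : ((Ideal.Quotient.mkₐ ℝ (Ideal.span {l})).comp (Polynomial.aeval t)).comp
        (aeval ![x, y]) = Ideal.Quotient.mkₐ ℝ (Ideal.span {l}) from DFunLike.congr_fun h p
    have he' : (C e * (C a ^ 2 + C b ^ 2) : MvPolynomial (Fin 2) ℝ) = 1 := by
      rw [← C_pow, ← C_pow, ← C_add, ← C_mul, he, C_1]
    have hxt : Polynomial.aeval t x = C b * t + C (-(a * c * e)) := by
      simp [hx, algebraMap_eq]
    have hyt : Polynomial.aeval t y = C (-a) * t + C (-(b * c * e)) := by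
      simp [hy, algebraMap_eq]
    refine MvPolynomial.algHom_ext fun i => ?_
    simp only [AlgHom.comp_apply, aeval_X, Ideal.Quotient.mkₐ_eq_mk]
    rw [Ideal.Quotient.mk_eq_mk_iff_sub_mem, Ideal.mem_span_singleton]
    fin_cases i
    · change l ∣ Polynomial.aeval t x - X 0
      refine ⟨-(C a * C e), ?_⟩
      rw [hxt, ht, hldef]
      simp only [C_mul, C_neg]
      linear_combination X 0 * he'
    · change l ∣ Polynomial.aeval t y - X 1
      refine ⟨-(C b * C e), ?_⟩
      rw [hyt, ht, hldef]
      simp only [C_mul, C_neg]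
      linear_combination X 1 * he'
  refine ⟨aeval ![x, y], fun A => e * (b * A.1 - a * A.2), fun p => ⟨fun h => ?_, ?_⟩,
    fun p => ?_, fun A hA B hB hAB => ?_, fun p A hA => ?_⟩
  · have := hψ p
    rw [h, map_zero, map_zero, eq_comm, Ideal.Quotient.mkₐ_eq_mk, Ideal.Quotient.eq_zero_iff_mem,
      Ideal.mem_span_singleton] at this
    exact this
  · rintro ⟨r, rfl⟩
    rw [map_mul, hφl, zero_mul]
  · have := aeval_natDegree_le p le_rfl ![x, y] (n := 1) (fun i => by
      fin_cases i <;> exact Polynomial.natDegree_linear_le)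
    simpa using this
  · have hA' := hpt A hA
    have hB' := hpt B hB
    simp only at hAB
    rw [hAB] at hA'
    exact Prod.ext (hA'.1.symm.trans hB'.1) (hA'.2.symm.trans hB'.2)
  · obtain ⟨h1, h2⟩ := hpt A hA
    suffices h : ((Polynomial.aeval (e * (b * A.1 - a * A.2))).comp (aeval ![x, y]) :
        MvPolynomial (Fin 2) ℝ →ₐ[ℝ] ℝ) = aeval ![A.1, A.2] by
      have := DFunLike.congr_fun h p
      simpa [ev, aeval_eq_eval, Polynomial.coe_aeval_eq_eval] using this
    refine MvPolynomial.algHom_ext fun i => ?_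
    fin_cases i
    · simpa [hx] using h1
    · simpa [hy] using h2

/-- A polynomial with more zeros on a line than its degree is divisible by the line. -/
lemma IsLinePoly.dvd_of_zeros {l : MvPolynomial (Fin 2) ℝ} (hl : IsLinePoly l)
    {p : MvPolynomial (Fin 2) ℝ} {S : Set (ℝ × ℝ)} (hS : S ⊆ lineSet l)
    (hcard : p.totalDegree < S.ncard) (hp : ∀ A ∈ S, ev p A = 0) : l ∣ p := by
  obtain ⟨φ, τ, hφ, hdeg, hinj, hev⟩ := hl.exists_restriction
  rw [← hφ]
  have hfin : S.Finite := Set.finite_of_ncard_pos (by omega)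
  refine Polynomial.eq_zero_of_natDegree_lt_card_of_eval_eq_zero' (φ p)
    (hfin.image τ).toFinset ?_ ?_
  · intro x hx
    rw [Set.Finite.mem_toFinset] at hx
    obtain ⟨A, hA, rfl⟩ := hx
    rw [hev p A (hS hA), hp A hA]
  · rw [← Set.ncard_eq_toFinset_card _ (hfin.image τ), (hinj.mono hS).ncard_image]
    exact (hdeg p).trans_lt hcard

/-- Cancelling a line from a product of lines leaves a product of lines. -/
lemma IsLinePoly.exists_prod_of_mul_eq {l r : MvPolynomial (Fin 2) ℝ} (hl : IsLinePoly l) {n : ℕ}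
    {f : Fin (n + 1) → MvPolynomial (Fin 2) ℝ} (hf : ∀ i, IsLinePoly (f i)) {c : ℝ} (hc : c ≠ 0)
    (h : l * r = C c * ∏ i, f i) :
    ∃ (d : ℝ) (g : Fin n → MvPolynomial (Fin 2) ℝ), d ≠ 0 ∧ (∀ i, IsLinePoly (g i)) ∧
      r = C d * ∏ i, g i := by
  obtain ⟨φ, τ, hφ, -⟩ := hl.exists_restriction
  have h0 : φ (∏ i, f i) = 0 := by
    have h1 : φ (C c * ∏ i, f i) = 0 := by rw [← h, hφ]; exact dvd_mul_right _ _
    rw [map_mul, mul_eq_zero] at h1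
    refine h1.resolve_left fun h2 => hc ?_
    simpa [algHom_C] using h2
  rw [map_prod, Finset.prod_eq_zero_iff] at h0
  obtain ⟨i, -, hi⟩ := h0
  obtain ⟨u, hu⟩ := (hφ _).1 hi
  have hu0 : u ≠ 0 := by
    rintro rfl
    exact (hf i).ne_zero (by rw [hu, mul_zero])
  have hud : u.totalDegree = 0 := by
    have h1 := hl.totalDegree_line_mul hu0
    rw [← hu, hf i] at h1
    omega
  obtain ⟨e, rfl⟩ : ∃ e, u = C e := ⟨_, totalDegree_eq_zero_iff_eq_C.1 hud⟩
  have he : e ≠ 0 := by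
    rintro rfl
    exact hu0 C_0
  refine ⟨c * e, fun j => f (i.succAbove j), mul_ne_zero hc he, fun j => hf _, ?_⟩
  rw [Fin.prod_univ_succAbove _ i, hu] at h
  apply mul_left_cancel₀ hl.ne_zero
  rw [h, C_mul]
  ring

/-- In a `2`-poised set every node has a fundamental polynomial. -/
lemma Poised.exists_isFund_two {X : Set (ℝ × ℝ)} (hX : Poised 2 X) {B : ℝ × ℝ} (hB : B ∈ X) :
    ∃ q, IsFund 2 X B q := by
  obtain ⟨hfin, hcard, huniq⟩ := hX
  have : Fintype X := hfin.fintype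
  let m : Fin 6 → (Fin 2 →₀ ℕ) := ![0, Finsupp.single 0 1, Finsupp.single 1 1, Finsupp.single 0 2,
    Finsupp.single 0 1 + Finsupp.single 1 1, Finsupp.single 1 2]
  have hm : Function.Injective m := by
    have h : Function.Injective fun i => (m i 0, m i 1) := by
      have : (fun i => (m i 0, m i 1)) = ![(0, 0), (1, 0), (0, 1), (2, 0), (1, 1), (0, 2)] := by
        funext i
        fin_cases i <;> simp [m]
      rw [this]
      decide
    intro i j hij
    exact h (by simp only [hij])
  have hmdeg : ∀ i, (m i).degree ≤ 2 := by
    intro i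
    fin_cases i <;> simp [m]
  let P : (Fin 6 → ℝ) →ₗ[ℝ] MvPolynomial (Fin 2) ℝ :=
    Fintype.linearCombination ℝ (fun i => monomial (m i) (1 : ℝ))
  have hPdeg : ∀ v, (P v).totalDegree ≤ 2 := by
    intro v
    simp only [P, Fintype.linearCombination_apply]
    refine totalDegree_finsetSum_le fun i _ => (totalDegree_smul_le _ _).trans ?_
    rw [totalDegree_monomial _ one_ne_zero]
    exact hmdeg i
  have hPinj : ∀ v, P v = 0 → v = 0 := by
    intro v hv
    funext j
    have := congrArg (coeff (m j)) hv
    simpa [P, Fintype.linearCombination_apply, coeff_sum, coeff_monomial, hm.eq_iff] using this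
  let E : (Fin 6 → ℝ) →ₗ[ℝ] (X → ℝ) :=
    (LinearMap.pi fun A : X => (aeval ![A.1.1, A.1.2] : MvPolynomial (Fin 2) ℝ →ₐ[ℝ] ℝ).toLinearMap)
      ∘ₗ P
  have hE : ∀ v (A : X), E v A = ev (P v) A := by
    intro v A
    simp [E, ev, aeval_eq_eval]
  have hEinj : Function.Injective E := by
    rw [← LinearMap.ker_eq_bot, LinearMap.ker_eq_bot']
    intro v hv
    refine hPinj v (huniq _ (hPdeg v) fun A hA => ?_)
    rw [← hE v ⟨A, hA⟩, hv]
    rfl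
  have hdim : Module.finrank ℝ (Fin 6 → ℝ) = Module.finrank ℝ (X → ℝ) := by
    rw [Module.finrank_fin_fun, Module.finrank_fintype_fun_eq_card, ← Nat.card_eq_fintype_card,
      Nat.card_coe_set_eq, hcard]
  obtain ⟨v, hv⟩ := (LinearMap.injective_iff_surjective_of_finrank_eq_finrank hdim).1 hEinj
    (Pi.single ⟨B, hB⟩ 1)
  refine ⟨P v, hPdeg v, ?_, fun A hA hAB => ?_⟩
  · rw [← hE v ⟨B, hB⟩, hv, Pi.single_eq_same]
  · rw [← hE v ⟨A, hA⟩, hv, Pi.single_eq_of_ne]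
    exact fun h => hAB (congrArg Subtype.val h)

/-- A node on a line `Q` does not use a line `P` if `P`, `Q` and some line `R` meet the node set
in disjoint sets, of which those on `Q` and `R` have five nodes. -/
lemma not_uses_of_disjoint_lines {X : Set (ℝ × ℝ)} {P Q R : MvPolynomial (Fin 2) ℝ}
    (hP : IsLinePoly P) (hQ : IsLinePoly Q) (hR : IsLinePoly R)
    (hQc : (X ∩ lineSet Q).ncard = 5) (hRc : (X ∩ lineSet R).ncard = 5)
    (hPQ : ∀ B ∈ X, ev P B = 0 → ev Q B ≠ 0) (hPR : ∀ B ∈ X, ev P B = 0 → ev R B ≠ 0)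
    (hQR : ∀ B ∈ X, ev Q B = 0 → ev R B ≠ 0) {A : ℝ × ℝ} (hA : A ∈ X) (hAQ : ev Q A = 0) :
    ¬ Uses 5 X A P := by
  rintro ⟨p, ⟨hdeg, hone, hzero⟩, r, rfl⟩
  have hr : r ≠ 0 := by
    rintro rfl
    simp [ev] at hone
  rw [hP.totalDegree_line_mul hr] at hdeg
  obtain ⟨s, rfl⟩ : R ∣ r := by
    refine hR.dvd_of_zeros (S := X ∩ lineSet R) Set.inter_subset_right (by omega) ?_
    rintro B ⟨hB, hBR⟩
    have h := hzero B hB (by rintro rfl; exact hQR B hB hAQ hBR)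
    rw [ev_mul] at h
    exact (mul_eq_zero.1 h).resolve_left fun h' => hPR B hB h' hBR
  rw [hR.totalDegree_line_mul (right_ne_zero_of_mul hr)] at hdeg
  obtain ⟨w, rfl⟩ : Q ∣ s := by
    refine hQ.dvd_of_zeros (S := (X ∩ lineSet Q) \ {A})
      (Set.sdiff_subset.trans Set.inter_subset_right) ?_ ?_
    · rw [Set.ncard_sdiff_singleton_of_mem (show A ∈ X ∩ lineSet Q from ⟨hA, hAQ⟩)]
      omega
    · rintro B ⟨⟨hB, hBQ⟩, hBA⟩
      have h := hzero B hB hBA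
      rw [ev_mul, ev_mul] at h
      have hBP : ev P B ≠ 0 := fun h' => hPQ B hB h' hBQ
      exact (mul_eq_zero.1 ((mul_eq_zero.1 h).resolve_left hBP)).resolve_left (hQR B hB hBQ)
  rw [ev_mul, ev_mul, ev_mul, hAQ] at hone
  simp at hone

/-- setup of the case `(5,5,5,3,2)`. With `𝒜 = X ∩ (ℓ1 ∪ ℓ2 ∪ ℓ3)` and
`ℬ = X \ 𝒜`: (i) `ℬ` is a `GC_2` set and for every `B ∈ ℬ` the fundamental polynomial of
`B` w.r.t. `X` factors as `ℓ1 ℓ2 ℓ3` times the fundamental polynomial of `B` w.r.t. `ℬ`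
(up to a nonzero constant); (ii) no node of `𝒜` uses any of `ℓ1, ℓ2, ℓ3`. -/
theorem lemma_A_B
    (X : Set (ℝ × ℝ)) (hX : GCSet 5 X) (hnm : NoMaximalLine 5 X)
    (A0 : ℝ × ℝ) (hA0 : A0 ∈ X) (L : Fin 5 → MvPolynomial (Fin 2) ℝ)
    (hL : MLineSeq X A0 L) (hk : ∀ s, resCount X L s (L s) = ![5, 5, 5, 3, 2] s)
    (SA SB : Set (ℝ × ℝ))
    (hSA : SA = X ∩ (lineSet (L 0) ∪ lineSet (L 1) ∪ lineSet (L 2)))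
    (hSB : SB = X \ SA) :
    GCSet 2 SB ∧
    (∀ B ∈ SB, ∀ p q : MvPolynomial (Fin 2) ℝ, IsFund 5 X B p → IsFund 2 SB B q →
      ∃ c : ℝ, c ≠ 0 ∧ p = MvPolynomial.C c * (L 0 * L 1 * L 2 * q)) ∧
    (∀ A ∈ SA, ¬ Uses 5 X A (L 0) ∧ ¬ Uses 5 X A (L 1) ∧ ¬ Uses 5 X A (L 2)) := by
  obtain ⟨⟨hfin, hcard, huniq⟩, hGC⟩ := hX
  obtain ⟨hline, -, -, hgreedy⟩ := hL
  have hfinsub : ∀ p : ℝ × ℝ → Prop, {B ∈ X | p B}.Finite := fun p =>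
    hfin.subset (Set.sep_subset _ _)
  have hk0 := hk 0
  have hle1 := hgreedy 0 1 (by decide)
  have hle2 := hgreedy 0 2 (by decide)
  have hk1 := hk 1
  have hk2 := hk 2
  rw [hk0] at hle1 hle2
  simp only [resCount, Fin.forall_fin_succ, Matrix.cons_val_zero, Matrix.cons_val_one,
    Matrix.cons_val] at hk0 hk1 hk2 hle1 hle2
  have hS0 : {B ∈ X | ev (L 0) B = 0}.ncard = 5 := by simpa using hk0
  have hS1 : {B ∈ X | ev (L 1) B = 0 ∧ ev (L 0) B ≠ 0}.ncard = 5 := by simpa using hk1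
  have hS2 : {B ∈ X | ev (L 2) B = 0 ∧ ev (L 0) B ≠ 0 ∧ ev (L 1) B ≠ 0}.ncard = 5 := by
    simpa [Fin.lt_def] using hk2
  have hT1 : {B ∈ X | ev (L 1) B = 0}.ncard ≤ 5 := by simpa using hle1
  have hT2 : {B ∈ X | ev (L 2) B = 0}.ncard ≤ 5 := by simpa using hle2
  have hE1 : {B ∈ X | ev (L 1) B = 0 ∧ ev (L 0) B ≠ 0} = {B ∈ X | ev (L 1) B = 0} :=
    Set.eq_of_subset_of_ncard_le (fun B hB => ⟨hB.1, hB.2.1⟩) (by omega) (hfinsub _)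
  have hE2 : {B ∈ X | ev (L 2) B = 0 ∧ ev (L 0) B ≠ 0 ∧ ev (L 1) B ≠ 0} =
      {B ∈ X | ev (L 2) B = 0} :=
    Set.eq_of_subset_of_ncard_le (fun B hB => ⟨hB.1, hB.2.1⟩) (by omega) (hfinsub _)
  rw [hE1] at hS1
  rw [hE2] at hS2
  have h10 : ∀ B ∈ X, ev (L 1) B = 0 → ev (L 0) B ≠ 0 := fun B hB h =>
    (hE1.ge ⟨hB, h⟩ : _ ∈ {B ∈ X | _}).2.2
  have h20 : ∀ B ∈ X, ev (L 2) B = 0 → ev (L 0) B ≠ 0 := fun B hB h =>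
    (hE2.ge ⟨hB, h⟩ : _ ∈ {B ∈ X | _}).2.2.1
  have h21 : ∀ B ∈ X, ev (L 2) B = 0 → ev (L 1) B ≠ 0 := fun B hB h =>
    (hE2.ge ⟨hB, h⟩ : _ ∈ {B ∈ X | _}).2.2.2
  have h01 : ∀ B ∈ X, ev (L 0) B = 0 → ev (L 1) B ≠ 0 := fun B hB h h' => h10 B hB h' h
  have h02 : ∀ B ∈ X, ev (L 0) B = 0 → ev (L 2) B ≠ 0 := fun B hB h h' => h20 B hB h' h
  have h12 : ∀ B ∈ X, ev (L 1) B = 0 → ev (L 2) B ≠ 0 := fun B hB h h' => h21 B hB h' h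
  have hSA' : SA = {B ∈ X | ev (L 0) B = 0} ∪ {B ∈ X | ev (L 1) B = 0} ∪
      {B ∈ X | ev (L 2) B = 0} := by
    rw [hSA, Set.inter_union_distrib_left, Set.inter_union_distrib_left]
    rfl
  have hSAcard : SA.ncard = 15 := by
    rw [hSA', Set.ncard_union_eq _ ((hfinsub _).union (hfinsub _)) (hfinsub _),
      Set.ncard_union_eq _ (hfinsub _) (hfinsub _), hS0, hS1, hS2]
    · exact Set.disjoint_left.2 fun B h h' => h01 B h.1 h.2 h'.2
    · refine Set.disjoint_left.2 fun B h h' => ?_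
      rcases h with h | h
      · exact h02 B h.1 h.2 h'.2
      · exact h12 B h.1 h.2 h'.2
  have hSBcard : SB.ncard = 6 := by
    have hsub : SA ⊆ X := hSA ▸ Set.inter_subset_left
    rw [hSB, Set.ncard_sdiff hsub (hfin.subset hsub), hcard, hSAcard]
  have hSBsub : SB ⊆ X := hSB ▸ Set.sdiff_subset
  have hmul : ∀ q A, ev (L 0 * L 1 * L 2 * q) A =
      ev (L 0) A * ev (L 1) A * ev (L 2) A * ev q A := fun q A => by simp only [ev_mul]
  have hmulA : ∀ q, ∀ A ∈ X, A ∉ SB → ev (L 0 * L 1 * L 2 * q) A = 0 := by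
    intro q A hA hAB
    have hAA : A ∈ SA := by
      by_contra h
      exact hAB (hSB ▸ ⟨hA, h⟩)
    rw [hSA'] at hAA
    rw [hmul]
    rcases hAA with (h | h) | h <;> simp [h.2]
  have hmulB : ∀ B ∈ SB, ev (L 0) B * ev (L 1) B * ev (L 2) B ≠ 0 := by
    intro B hB h
    rw [hSB, hSA'] at hB
    refine hB.2 ?_
    rcases mul_eq_zero.1 h with h | h
    · rcases mul_eq_zero.1 h with h | h
      · exact Or.inl (Or.inl ⟨hB.1, h⟩)
      · exact Or.inl (Or.inr ⟨hB.1, h⟩)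
    · exact Or.inr ⟨hB.1, h⟩
  have hmuldeg : ∀ q : MvPolynomial (Fin 2) ℝ, q.totalDegree ≤ 2 →
      (L 0 * L 1 * L 2 * q).totalDegree ≤ 5 := by
    intro q hq
    have h1 := totalDegree_mul (L 0 * L 1 * L 2) q
    have h2 := totalDegree_mul (L 0 * L 1) (L 2)
    have h3 := totalDegree_mul (L 0) (L 1)
    have := hline 0
    have := hline 1
    have := hline 2
    unfold IsLinePoly at *
    omega
  have hL3 : L 0 * L 1 * L 2 ≠ 0 :=
    mul_ne_zero (mul_ne_zero (hline 0).ne_zero (hline 1).ne_zero) (hline 2).ne_zero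
  have hpoised : Poised 2 SB := by
    refine ⟨hfin.subset hSBsub, hSBcard, fun q hq hz => ?_⟩
    have h := huniq _ (hmuldeg q hq) fun A hA => ?_
    · exact (mul_eq_zero.1 h).resolve_left hL3
    · by_cases hAB : A ∈ SB
      · rw [hmul, hz A hAB, mul_zero]
      · exact hmulA q A hA hAB
  have hfactor : ∀ B ∈ SB, ∀ p q : MvPolynomial (Fin 2) ℝ, IsFund 5 X B p → IsFund 2 SB B q →
      ∃ c : ℝ, c ≠ 0 ∧ p = MvPolynomial.C c * (L 0 * L 1 * L 2 * q) := by
    rintro B hB p q ⟨hpd, hp1, hp0⟩ ⟨hqd, hq1, hq0⟩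
    have hv := hmulB B hB
    refine ⟨_, inv_ne_zero hv, sub_eq_zero.1 (huniq _ ?_ fun A hA => ?_)⟩
    · refine (totalDegree_sub _ _).trans (max_le hpd ((totalDegree_mul _ _).trans ?_))
      rw [totalDegree_C, zero_add]
      exact hmuldeg q hqd
    · rw [ev_sub, ev_mul, ev_C]
      by_cases hAB : A = B
      · rw [hAB, hmul, hp1, hq1, mul_one, inv_mul_cancel₀ hv, sub_self]
      · rw [hp0 A hA hAB, zero_sub, neg_eq_zero]
        by_cases hA' : A ∈ SB
        · rw [hmul, hq0 A hA' hAB, mul_zero, mul_zero]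
        · rw [hmulA q A hA hA', mul_zero]
  refine ⟨⟨hpoised, fun B hB => ?_⟩, hfactor, fun A hA => ?_⟩
  · obtain ⟨q, hq⟩ := hpoised.exists_isFund_two hB
    obtain ⟨p, hp, f, hf, hpf⟩ := hGC B (hSBsub hB)
    obtain ⟨c, hc, hpq⟩ := hfactor B hB p q hp hq
    have e0 : L 0 * (L 1 * (L 2 * q)) = C c⁻¹ * ∏ i, f i := by
      rw [← hpf, hpq, ← mul_assoc (C c⁻¹), ← C_mul, inv_mul_cancel₀ hc, C_1]
      ring
    obtain ⟨c1, f1, hc1, hf1, e1⟩ := (hline 0).exists_prod_of_mul_eq hf (inv_ne_zero hc) e0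
    obtain ⟨c2, f2, hc2, hf2, e2⟩ := (hline 1).exists_prod_of_mul_eq hf1 hc1 e1
    obtain ⟨d, g, hd, hg, e3⟩ := (hline 2).exists_prod_of_mul_eq hf2 hc2 e2
    refine ⟨q, hq, ![C d * g 0, g 1], fun i => ?_, ?_⟩
    · fin_cases i
      · change (C d * g 0).totalDegree = 1
        rw [totalDegree_mul_of_isDomain (C_ne_zero.2 hd) (hg 0).ne_zero, totalDegree_C, hg 0]
      · exact hg 1
    · rw [e3]
      simp [Fin.prod_univ_two, mul_assoc]
  · have hself : ∀ l, ev l A = 0 → ¬ Uses 5 X A l := by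
      rintro l hl ⟨p, ⟨-, hp1, -⟩, r, rfl⟩
      rw [ev_mul, hl, zero_mul] at hp1
      exact zero_ne_one hp1
    rw [hSA'] at hA
    rcases hA with (⟨hA, h⟩ | ⟨hA, h⟩) | ⟨hA, h⟩
    · exact ⟨hself _ h,
        not_uses_of_disjoint_lines (hline 1) (hline 0) (hline 2) hS0 hS2 h10 h12 h02 hA h,
        not_uses_of_disjoint_lines (hline 2) (hline 0) (hline 1) hS0 hS1 h20 h21 h01 hA h⟩
    · exact ⟨not_uses_of_disjoint_lines (hline 0) (hline 1) (hline 2) hS1 hS2 h01 h02 h12 hA h,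
        hself _ h,
        not_uses_of_disjoint_lines (hline 2) (hline 1) (hline 0) hS1 hS0 h21 h20 h10 hA h⟩
    · exact ⟨not_uses_of_disjoint_lines (hline 0) (hline 2) (hline 1) hS2 hS1 h02 h01 h21 hA h,
        not_uses_of_disjoint_lines (hline 1) (hline 2) (hline 0) hS2 hS0 h12 h10 h20 hA h,
        hself _ h⟩
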